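/- Correctness of the dual max-deque for the Eventually operator: for every signal stream with strictly increasing times, every window size w > 0, and every step k, the front value of the max-deque state obtained by processing the first k samples equals the naive sliding-window maximum max{v_i : 1 ≤ i ≤ k and t_k − w ≤ t_i ≤ t_k}. -/

import Mathlib

open scoped Classical

/-- One processing step of the monotonic max-deque for window size `w`:
PopFront (drop expired times `< tk - w`), PopBack (drop back values `< vk`),
then PushBack `(tk, vk)`. -/
noncomputable def maxDequeStep (w tk vk : ℝ) (D : List (ℝ × ℝ)) : List (ℝ × ℝ) :=
  (((D.dropWhile (fun p => decide (p.1 < tk - w))).reverse.dropWhile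
      (fun p => decide (p.2 < vk))).reverse) ++ [(tk, vk)]

/-- The max-deque state after processing samples `1, …, k` of the stream
`(t i, v i)`, starting from the empty deque. -/
noncomputable def maxDequeRun (w : ℝ) (t v : ℕ → ℝ) : ℕ → List (ℝ × ℝ)
  | 0 => []
  | (k+1) => maxDequeStep w (t (k+1)) (v (k+1)) (maxDequeRun w t v k)

/-- The naive sliding-window maximum: the maximum (supremum) of the finite
nonempty set of in-window values `{v i : 1 ≤ i ≤ k, t k - w ≤ t i ≤ t k}`. -/
noncomputable def naiveMax (w : ℝ) (t v : ℕ → ℝ) (k : ℕ) : ℝ :=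
  sSup (v '' {i | 1 ≤ i ∧ i ≤ k ∧ t k - w ≤ t i ∧ t i ≤ t k})

theorem mem_dropWhile_of_pairwise {α : Type*} (R : α → α → Prop) (P : α → Bool)
    (hR : ∀ a b, R a b → P a = false → P b = false) (l : List α) (hl : l.Pairwise R) (x : α) :
    x ∈ l.dropWhile P ↔ x ∈ l ∧ P x = false := by
  induction l with
  | nil => simp
  | cons a l ih =>
    rw [List.pairwise_cons] at hl
    have ih := ih hl.2
    by_cases h : P a = true
    · rw [List.dropWhile_cons_of_pos h, ih, List.mem_cons]
      constructor
      · rintro ⟨h1, h2⟩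
        exact ⟨Or.inr h1, h2⟩
      · rintro ⟨h1 | h1, h2⟩
        · subst h1
          simp [h] at h2
        · exact ⟨h1, h2⟩
    · rw [List.dropWhile_cons_of_neg h]
      have h' : P a = false := by simpa using h
      constructor
      · intro hx
        refine ⟨hx, ?_⟩
        rcases List.mem_cons.1 hx with rfl | hx
        · exact h'
        · exact hR a x (hl.1 x hx) h'
      · exact fun hx => hx.1

/-- The ordering maintained along the deque. -/
def DequeRel (p q : ℝ × ℝ) : Prop := p.1 < q.1 ∧ q.2 ≤ p.2

theorem mem_maxDequeStep (w tk vk : ℝ) (D : List (ℝ × ℝ)) (hD : D.Pairwise DequeRel)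
    (x : ℝ × ℝ) :
    x ∈ maxDequeStep w tk vk D ↔ (x ∈ D ∧ tk - w ≤ x.1 ∧ vk ≤ x.2) ∨ x = (tk, vk) := by
  have h1 : (D.dropWhile (fun p => decide (p.1 < tk - w))).Pairwise DequeRel :=
    hD.sublist (List.dropWhile_sublist _)
  unfold maxDequeStep
  rw [List.mem_append, List.mem_reverse,
    mem_dropWhile_of_pairwise (fun a b => DequeRel b a) _ _ _ (List.pairwise_reverse.2 h1),
    List.mem_reverse, mem_dropWhile_of_pairwise DequeRel _ _ _ hD]
  · simp [and_assoc]
  · intro a b h h2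
    simp only [decide_eq_false_iff_not, not_lt] at *
    exact h2.trans h.1.le
  · intro a b h h2
    simp only [decide_eq_false_iff_not, not_lt] at *
    exact h2.trans h.2

theorem pairwise_maxDequeStep (w tk vk : ℝ) (D : List (ℝ × ℝ)) (hD : D.Pairwise DequeRel)
    (ht : ∀ p ∈ D, p.1 < tk) : (maxDequeStep w tk vk D).Pairwise DequeRel := by
  have h1 : (D.dropWhile (fun p => decide (p.1 < tk - w))).Pairwise DequeRel :=
    hD.sublist (List.dropWhile_sublist _)
  have hm := mem_maxDequeStep w tk vk D hD
  unfold maxDequeStep at *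
  rw [List.pairwise_append]
  refine ⟨?_, List.pairwise_singleton _ _, ?_⟩
  · exact List.pairwise_reverse.2
      ((List.pairwise_reverse.2 h1).sublist (List.dropWhile_sublist _))
  · intro a ha b hb
    rw [List.mem_singleton] at hb
    subst hb
    have haD : a ∈ D := by
      rw [List.mem_reverse] at ha
      exact (List.dropWhile_sublist _).subset
        (List.mem_reverse.1 ((List.dropWhile_sublist _).subset ha))
    rcases (hm a).1 (List.mem_append_left _ ha) with h | h
    · exact ⟨ht a haD, h.2.2⟩
    · have := ht a haD
      rw [h] at this
      exact absurd this (lt_irrefl _)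

theorem maxDequeRun_inv (n : ℕ) (t v : ℕ → ℝ) (w : ℝ)
    (hmono : ∀ i j, 1 ≤ i → i < j → j ≤ n → t i < t j) (hw : 0 < w) (k : ℕ) (hkn : k ≤ n) :
    (maxDequeRun w t v k).Pairwise DequeRel ∧
    (∀ p ∈ maxDequeRun w t v k, ∃ i, 1 ≤ i ∧ i ≤ k ∧ t k - w ≤ t i ∧ p = (t i, v i)) ∧
    (∀ i, 1 ≤ i → i ≤ k → t k - w ≤ t i →
      ∃ p ∈ maxDequeRun w t v k, t i ≤ p.1 ∧ v i ≤ p.2) := by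
  induction k with
  | zero =>
    refine ⟨by simp [maxDequeRun], by simp [maxDequeRun], ?_⟩
    intro i h1 h2
    omega
  | succ k ih =>
    obtain ⟨hp, ha, hc⟩ := ih (by omega)
    have ht : ∀ p ∈ maxDequeRun w t v k, p.1 < t (k+1) := by
      intro p hpm
      obtain ⟨i, h1, h2, -, rfl⟩ := ha p hpm
      exact hmono i (k+1) h1 (by omega) hkn
    have hm := mem_maxDequeStep w (t (k+1)) (v (k+1)) _ hp
    simp only [maxDequeRun]
    refine ⟨pairwise_maxDequeStep _ _ _ _ hp ht, ?_, ?_⟩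
    · intro p hpm
      rcases (hm p).1 hpm with ⟨h1, h2, h3⟩ | h
      · obtain ⟨i, i1, i2, -, rfl⟩ := ha p h1
        exact ⟨i, i1, by omega, h2, rfl⟩
      · exact ⟨k+1, by omega, le_rfl, by linarith, h⟩
    · intro i i1 i2 i3
      have hlast := (hm (t (k+1), v (k+1))).2 (Or.inr rfl)
      rcases Nat.lt_or_ge k i with hik | hik
      · obtain rfl : i = k + 1 := by omega
        exact ⟨_, hlast, le_rfl, le_rfl⟩
      · have hkk : t k < t (k+1) := hmono k (k+1) (by omega) (by omega) hkn
        obtain ⟨p, hpm, h1, h2⟩ := hc i i1 hik (by linarith)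
        by_cases hv : v (k+1) ≤ p.2
        · exact ⟨p, (hm p).2 (Or.inl ⟨hpm, by linarith, hv⟩), h1, h2⟩
        · exact ⟨_, hlast, (hmono i (k+1) i1 (by omega) hkn).le, by
            show v i ≤ v (k+1)
            linarith⟩

/-- **Correctness of the dual max-deque (Eventually operator).** For every
signal stream with strictly increasing times, every window size `w > 0`, and
every step `1 ≤ k ≤ n`, the max-deque state after processing the first `k`
samples is nonempty and its front value equals the naive sliding-window
maximum. -/
theorem maxDeque_front_eq_naiveMax
    (n : ℕ) (t v : ℕ → ℝ) (w : ℝ)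
    (hmono : ∀ i j, 1 ≤ i → i < j → j ≤ n → t i < t j)
    (hw : 0 < w)
    (k : ℕ) (hk1 : 1 ≤ k) (hkn : k ≤ n) :
    ∃ p rest, maxDequeRun w t v k = p :: rest ∧ p.2 = naiveMax w t v k := by
  obtain ⟨hp, ha, hc⟩ := maxDequeRun_inv n t v w hmono hw k hkn
  obtain ⟨q, hq, -, -⟩ := hc k hk1 le_rfl (by linarith)
  cases hD : maxDequeRun w t v k with
  | nil =>
    rw [hD] at hq
    simp at hq
  | cons p rest =>
    refine ⟨p, rest, rfl, ?_⟩
    rw [hD] at hp ha hc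
    obtain ⟨i, i1, i2, i3, hpi⟩ := ha p List.mem_cons_self
    have hle : t i ≤ t k := by
      rcases Nat.lt_or_ge i k with h | h
      · exact (hmono i k i1 h hkn).le
      · obtain rfl : i = k := by omega
        exact le_rfl
    have hg : IsGreatest (v '' {i | 1 ≤ i ∧ i ≤ k ∧ t k - w ≤ t i ∧ t i ≤ t k}) p.2 := by
      refine ⟨⟨i, ⟨i1, i2, i3, hle⟩, by rw [hpi]⟩, ?_⟩
      rintro _ ⟨j, ⟨j1, j2, j3, -⟩, rfl⟩
      obtain ⟨r, hr, -, h2⟩ := hc j j1 j2 j3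
      rcases List.mem_cons.1 hr with rfl | hr
      · exact h2
      · exact h2.trans ((List.pairwise_cons.1 hp).1 r hr).2
    exact hg.csSup_eq.symm
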